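/- For any nonempty list of n leaf hashes and any index i < n, the inclusion proof for index i contains at most ⌈log₂ n⌉ sibling hashes. -/

import Mathlib

/-- Side of a sibling hash in an inclusion proof. -/
inductive Side
  | left
  | right
deriving DecidableEq, Repr

/-- One Merkle level step: combine consecutive pairs with `H`,
promoting an unpaired final element unchanged. -/
def levelStep {α : Type*} (H : α → α → α) : List α → List α
  | a :: b :: rest => H a b :: levelStep H rest
  | l => l

theorem levelStep_length {α : Type*} (H : α → α → α) :
    (l : List α) → (levelStep H l).length = (l.length + 1) / 2
  | [] => by simp [levelStep]
  | [_] => by simp [levelStep]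
  | a :: b :: rest => by
      simp only [levelStep, List.length_cons, levelStep_length H rest]
      omega

/-- The inclusion proof for leaf index `i`: the list of sibling hashes,
tagged with their side, along the path from leaf `i` to the root. -/
def merkleProof {α : Type*} (H : α → α → α) : List α → ℕ → List (Side × α)
  | [], _ => []
  | [_], _ => []
  | (a :: b :: rest), i =>
      (if i % 2 = 0 then
        match (a :: b :: rest)[i + 1]? with
        | some s => [(Side.right, s)]
        | none => []
      else
        match (a :: b :: rest)[i - 1]? with
        | some s => [(Side.left, s)]
        | none => []) ++ merkleProof H (levelStep H (a :: b :: rest)) (i / 2)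
termination_by l _ => l.length
decreasing_by
  simp only [levelStep_length, List.length_cons]
  omega

theorem merkleProof_length_aux {α : Type*} (H : α → α → α) (l : List α) (i : ℕ) :
    (merkleProof H l i).length ≤ Nat.clog 2 l.length := by
  induction l, i using merkleProof.induct H with
  | case1 i => simp [merkleProof]
  | case2 a i => simp [merkleProof]
  | case3 a b rest i ih =>
    rw [merkleProof, List.length_append,
      Nat.clog_of_two_le (b := 2) (n := (a :: b :: rest).length) (by norm_num) (by simp)]
    rw [levelStep_length] at ih
    have h : ((a :: b :: rest).length + 2 - 1) / 2 = ((a :: b :: rest).length + 1) / 2 := by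
      congr 1
    rw [h, add_comm]
    refine Nat.add_le_add ih ?_
    split_ifs <;> split <;> simp

/-- For any nonempty list of `n` leaf hashes and any index `i < n`, the
inclusion proof for index `i` contains at most `⌈log₂ n⌉` sibling hashes. -/
theorem merkleProof_length_le_clog {α : Type*} (H : α → α → α)
    (hs : List α) (hne : hs ≠ []) (i : ℕ) (hi : i < hs.length) :
    (merkleProof H hs i).length ≤ Nat.clog 2 hs.length := by
  exact merkleProof_length_aux H hs i
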